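/- arXiv:1204.1208 — 3 statements merged into one kernel-verified Lean document; each statement's English description precedes it below -/
import Mathlib

section
/- Let F be a Borel probability measure on [0,∞) that follows a power law with tail exponent α > d, i.e. F̄(r) = F((r,∞)) = ℓ(r)·r^{−α} with ℓ slowly varying. Then there exist constants u > 0 and c > 0 such that ∫_{[0,∞)} |B_{r₁+r}(0) ∩ B_{r₂+r}(z)| F(dr) ≤ c·F̄(|z|)·|z|^d whenever z ∈ ℝ^d with |z| > u and r₁, r₂ ≥ 0 with r₁ + r₂ ≤ |z|/2. -/
open MeasureTheory Filter Set Metric ProbabilityTheory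

noncomputable section

/-- A measurable positive function is slowly varying at infinity if `ℓ(a t)/ℓ(t) → 1`
as `t → ∞` for every `a > 0`. -/
def SlowlyVarying (ℓ : ℝ → ℝ) : Prop :=
  Measurable ℓ ∧ (∀ x > 0, 0 < ℓ x) ∧
    ∀ a > 0, Tendsto (fun t => ℓ (a * t) / ℓ t) atTop (nhds 1)

/-- Tail function `F̄(x) = F((x,∞))` of a measure on `ℝ`. -/
def tailF (F : Measure ℝ) (x : ℝ) : ℝ := (F (Ioi x)).toReal

/-- `d`-dimensional Euclidean space. -/
abbrev Euc (d : ℕ) := EuclideanSpace ℝ (Fin d)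

/-- The first standard basis vector of `ℝ^d`. -/
def e1 (d : ℕ) : Euc d := if h : 0 < d then EuclideanSpace.single (⟨0, h⟩ : Fin d) 1 else 0

/-- Volume of the closed ball of radius `r` in `ℝ^d`. -/
def ballVol (d : ℕ) (r : ℝ) : ℝ := (volume (closedBall (0 : Euc d) r)).toReal

/-- Volume of the intersection of closed balls `B_r(x)` and `B_s(y)` in `ℝ^d`. -/
def interVol (d : ℕ) (x : Euc d) (r : ℝ) (y : Euc d) (s : ℝ) : ℝ :=
  (volume (closedBall x r ∩ closedBall y s)).toReal

/-- The constant `c_{α,d} = ∫₀^∞ |B_r(0) ∩ B_r(e₁)| α r^{-α-1} dr`. -/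
def cconst (d : ℕ) (α : ℝ) : ℝ :=
  ∫ r in Ioi (0 : ℝ), interVol d 0 r (e1 d) r * (α * r ^ (-α - 1))

theorem tailF_ratio (F : Measure ℝ) (α : ℝ) (ℓ : ℝ → ℝ) (hℓ : SlowlyVarying ℓ)
    (htail : ∀ x > 0, tailF F x = ℓ x * x ^ (-α)) (a : ℝ) (ha : 0 < a) :
    Tendsto (fun t => tailF F (a * t) / tailF F t) atTop (nhds (a ^ (-α))) := by
  have h := (hℓ.2.2 a ha).mul_const (a ^ (-α))
  rw [one_mul] at h
  refine h.congr' ?_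
  filter_upwards [eventually_gt_atTop 0] with t ht
  rw [htail _ (mul_pos ha ht), htail t ht, Real.mul_rpow ha.le ht.le]
  have h1 := hℓ.2.1 t ht
  have h2 : 0 < t ^ (-α) := Real.rpow_pos_of_pos ht _
  field_simp

theorem tailF_pos (F : Measure ℝ) (α : ℝ) (ℓ : ℝ → ℝ) (hℓ : SlowlyVarying ℓ)
    (htail : ∀ x > 0, tailF F x = ℓ x * x ^ (-α)) (t : ℝ) (ht : 0 < t) : 0 < tailF F t := by
  rw [htail t ht]
  exact mul_pos (hℓ.2.1 t ht) (Real.rpow_pos_of_pos ht _)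

theorem interVol_nonneg (d : ℕ) (x : Euc d) (r : ℝ) (y : Euc d) (s : ℝ) :
    0 ≤ interVol d x r y s := ENNReal.toReal_nonneg

theorem interVol_zero (d : ℕ) (z : Euc d) (r s : ℝ) (h : r + s < ‖z‖) :
    interVol d 0 r z s = 0 := by
  have : closedBall (0 : Euc d) r ∩ closedBall z s = ∅ := by
    rw [← Set.disjoint_iff_inter_eq_empty]
    apply closedBall_disjoint_closedBall
    rwa [dist_zero_left]
  simp [interVol, this]

theorem interVol_le (d : ℕ) (z : Euc d) (r s : ℝ) (hr : 0 ≤ r) :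
    interVol d 0 r z s ≤ r ^ d * (volume (ball (0 : Euc d) 1)).toReal := by
  have h1 : volume (closedBall (0 : Euc d) r)
      = ENNReal.ofReal (r ^ d) * volume (ball (0 : Euc d) 1) := by
    rw [Measure.addHaar_closedBall _ _ hr]
    simp
  calc interVol d 0 r z s ≤ (volume (closedBall (0 : Euc d) r)).toReal := by
        apply ENNReal.toReal_mono measure_closedBall_lt_top.ne
        exact measure_mono inter_subset_left
    _ = _ := by
        rw [h1, ENNReal.toReal_mul, ENNReal.toReal_ofReal (by positivity)]

theorem moment_bound (d : ℕ) (F : Measure ℝ) [IsProbabilityMeasure F] (q T : ℝ) (hT : 0 < T)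
    (hq : 0 < q) (hq1 : 2 ^ d * q < 1)
    (hstep : ∀ t ≥ T, tailF F (2 * t) ≤ q * tailF F t) :
    ∫⁻ r in Ioi T, ENNReal.ofReal (r ^ d) ∂F
      ≤ ENNReal.ofReal ((2 * T) ^ d * tailF F T * (1 - 2 ^ d * q)⁻¹) := by
  have hk : ∀ k : ℕ, tailF F (2 ^ k * T) ≤ q ^ k * tailF F T := by
    intro k
    induction k with
    | zero => simp
    | succ k ih =>
      have h1 : (2 : ℝ) ^ k * T ≥ T := by
        have : (1 : ℝ) ≤ 2 ^ k := one_le_pow₀ (by norm_num)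
        nlinarith
      calc tailF F (2 ^ (k + 1) * T) = tailF F (2 * (2 ^ k * T)) := by ring_nf
        _ ≤ q * tailF F (2 ^ k * T) := hstep _ h1
        _ ≤ q * (q ^ k * tailF F T) := by gcongr
        _ = _ := by ring
  have hcover : Ioi T ⊆ ⋃ k : ℕ, Ioc (2 ^ k * T) (2 ^ (k + 1) * T) := by
    intro r hr
    have hr' : T < r := hr
    have hex : ∃ n : ℕ, r ≤ 2 ^ n * T := by
      obtain ⟨n, hn⟩ := pow_unbounded_of_one_lt (r / T) (by norm_num : (1 : ℝ) < 2)
      exact ⟨n, by rw [div_lt_iff₀ hT] at hn; exact hn.le⟩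
    classical
    have hs := Nat.find_spec hex
    have hm := fun m => @Nat.find_min _ _ hex m
    generalize Nat.find hex = n at hs hm
    cases n with
    | zero => simp at hs; linarith
    | succ k =>
      refine mem_iUnion.2 ⟨k, ?_, hs⟩
      exact not_le.1 (hm k (Nat.lt_succ_self k))
  have htn : 0 ≤ tailF F T := ENNReal.toReal_nonneg
  have hx0 : 0 ≤ 2 ^ d * q := by positivity
  calc ∫⁻ r in Ioi T, ENNReal.ofReal (r ^ d) ∂F
      ≤ ∫⁻ r in ⋃ k : ℕ, Ioc (2 ^ k * T) (2 ^ (k + 1) * T), ENNReal.ofReal (r ^ d) ∂F :=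
        lintegral_mono_set hcover
    _ ≤ ∑' k : ℕ, ∫⁻ r in Ioc (2 ^ k * T) (2 ^ (k + 1) * T), ENNReal.ofReal (r ^ d) ∂F :=
        lintegral_iUnion_le _ _
    _ ≤ ∑' k : ℕ, ENNReal.ofReal ((2 * T) ^ d * tailF F T * (2 ^ d * q) ^ k) := by
        refine ENNReal.tsum_le_tsum fun k => ?_
        calc ∫⁻ r in Ioc (2 ^ k * T) (2 ^ (k + 1) * T), ENNReal.ofReal (r ^ d) ∂F
            ≤ ∫⁻ r in Ioc (2 ^ k * T) (2 ^ (k + 1) * T),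
                ENNReal.ofReal ((2 ^ (k + 1) * T) ^ d) ∂F := by
              refine setLIntegral_mono measurable_const fun r hr => ?_
              apply ENNReal.ofReal_le_ofReal
              have : 0 ≤ r := le_trans (by positivity) hr.1.le
              exact pow_le_pow_left₀ this hr.2 d
          _ = ENNReal.ofReal ((2 ^ (k + 1) * T) ^ d)
                * F (Ioc (2 ^ k * T) (2 ^ (k + 1) * T)) := by
              rw [setLIntegral_const]
          _ ≤ ENNReal.ofReal ((2 ^ (k + 1) * T) ^ d) * F (Ioi (2 ^ k * T)) := by
              gcongr
              exact Ioc_subset_Ioi_self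
          _ = ENNReal.ofReal ((2 ^ (k + 1) * T) ^ d * tailF F (2 ^ k * T)) := by
              rw [ENNReal.ofReal_mul (by positivity), tailF,
                ENNReal.ofReal_toReal (measure_ne_top _ _)]
          _ ≤ _ := by
              apply ENNReal.ofReal_le_ofReal
              calc _ ≤ (2 ^ (k + 1) * T) ^ d * (q ^ k * tailF F T) := by
                    gcongr
                    exact hk k
                _ = _ := by
                    rw [mul_pow, mul_pow, mul_pow, ← pow_mul, ← pow_mul, add_mul, pow_add,
                      one_mul, mul_comm d k]
                    ring
    _ = _ := by
        rw [← ENNReal.ofReal_tsum_of_nonneg (fun k => by positivity)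
          ((summable_geometric_of_lt_one hx0 hq1).mul_left _), tsum_mul_left,
          tsum_geometric_of_lt_one hx0 hq1]

/-- Uniform bound on the average intersection volume of distant balls. -/
theorem stmt5 (d : ℕ) (hd : 0 < d) (F : Measure ℝ) [IsProbabilityMeasure F]
    (hsupp : F (Iio 0) = 0) (α : ℝ) (hα : (d : ℝ) < α)
    (ℓ : ℝ → ℝ) (hℓ : SlowlyVarying ℓ)
    (htail : ∀ x > 0, tailF F x = ℓ x * x ^ (-α)) :
    ∃ u > 0, ∃ c > 0, ∀ (z : Euc d) (r₁ r₂ : ℝ), 0 ≤ r₁ → 0 ≤ r₂ →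
      u < ‖z‖ → r₁ + r₂ ≤ ‖z‖ / 2 →
      (∫ r, interVol d 0 (r₁ + r) z (r₂ + r) ∂F) ≤ c * tailF F ‖z‖ * ‖z‖ ^ d := by
  obtain ⟨q, hq0, hq1⟩ : ∃ q, (2 : ℝ) ^ (-α) < q ∧ q < (2 : ℝ) ^ (-(d : ℝ)) :=
    exists_between (Real.rpow_lt_rpow_of_exponent_lt (by norm_num) (by linarith))
  have hqpos : 0 < q := lt_trans (Real.rpow_pos_of_pos (by norm_num) _) hq0
  have hq2 : 2 ^ d * q < 1 := by
    rw [Real.rpow_neg (by norm_num), Real.rpow_natCast] at hq1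
    have h2 : (0 : ℝ) < 2 ^ d := by positivity
    calc 2 ^ d * q < 2 ^ d * (2 ^ d)⁻¹ := by gcongr
      _ = 1 := by field_simp
  have ev1 := (tailF_ratio F α ℓ hℓ htail 2 (by norm_num)).eventually_lt_const hq0
  have h8 : (0 : ℝ) < 8 ^ (-α) := Real.rpow_pos_of_pos (by norm_num) _
  have ev2 := (tailF_ratio F α ℓ hℓ htail 8 (by norm_num)).eventually_const_lt (half_lt_self h8)
  obtain ⟨t0, ht0⟩ := eventually_atTop.1 ((ev1.and ev2).and (eventually_gt_atTop 0))
  have ht0pos : 0 < t0 := (ht0 t0 le_rfl).2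
  have hstep : ∀ t ≥ t0, tailF F (2 * t) ≤ q * tailF F t := fun t ht => by
    have := (ht0 t ht).1.1
    rw [div_lt_iff₀ (tailF_pos F α ℓ hℓ htail t (ht0 t ht).2)] at this
    exact this.le
  have hstep8 : ∀ t ≥ t0, tailF F t ≤ (8 ^ (-α) / 2)⁻¹ * tailF F (8 * t) := fun t ht => by
    have := (ht0 t ht).1.2
    rw [lt_div_iff₀ (tailF_pos F α ℓ hℓ htail t (ht0 t ht).2)] at this
    rw [inv_mul_eq_div, le_div_iff₀ (by positivity)]
    linarith
  set κ := (volume (ball (0 : Euc d) 1)).toReal with hκ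
  have hκ0 : 0 < κ := ENNReal.toReal_pos (measure_ball_pos _ _ one_pos).ne' measure_ball_lt_top.ne
  have hden : 0 < (1 - 2 ^ d * q)⁻¹ := inv_pos.2 (by linarith)
  refine ⟨8 * t0, by positivity,
    3 ^ d * κ * ((1 / 4) ^ d * (8 ^ (-α) / 2)⁻¹ * (1 - 2 ^ d * q)⁻¹), by positivity, ?_⟩
  intro z r₁ r₂ hr₁ hr₂ hz hr
  obtain ⟨T, hT⟩ : ∃ T, ‖z‖ = 8 * T := ⟨‖z‖ / 8, by ring⟩
  rw [hT] at hz hr ⊢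
  have hTt : t0 < T := by linarith
  have hTpos : 0 < T := by linarith
  have htT : 0 ≤ tailF F T := ENNReal.toReal_nonneg
  have hmain := moment_bound d F q T hTpos hqpos hq2 (fun t ht => hstep t (by linarith))
  have hC : 3 ^ d * κ * ((2 * T) ^ d * tailF F T * (1 - 2 ^ d * q)⁻¹) ≤
      3 ^ d * κ * ((1 / 4) ^ d * (8 ^ (-α) / 2)⁻¹ * (1 - 2 ^ d * q)⁻¹) * tailF F (8 * T)
        * (8 * T) ^ d := by
    calc _ ≤ 3 ^ d * κ * ((2 * T) ^ d * ((8 ^ (-α) / 2)⁻¹ * tailF F (8 * T))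
          * (1 - 2 ^ d * q)⁻¹) := by
          gcongr
          exact hstep8 T hTt.le
      _ = _ := by
          rw [show (2 * T) ^ d = (1 / 4) ^ d * (8 * T) ^ d by rw [← mul_pow]; ring_nf]
          ring
  refine le_trans ?_ hC
  by_cases hint : Integrable (fun r => interVol d 0 (r₁ + r) z (r₂ + r)) F
  swap
  · rw [integral_undef hint]; positivity
  rw [← ENNReal.ofReal_le_ofReal_iff (by positivity),
    ofReal_integral_eq_lintegral_ofReal hint
      (Eventually.of_forall fun r => interVol_nonneg _ _ _ _ _)]
  calc ∫⁻ r, ENNReal.ofReal (interVol d 0 (r₁ + r) z (r₂ + r)) ∂F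
      ≤ ∫⁻ r, (Ioi T).indicator
          (fun r => ENNReal.ofReal (3 ^ d * κ) * ENNReal.ofReal (r ^ d)) r ∂F := by
        refine lintegral_mono fun r => ?_
        by_cases hrr : 2 * T ≤ r
        · rw [indicator_of_mem (show r ∈ Ioi T from by simp only [mem_Ioi]; linarith),
            ← ENNReal.ofReal_mul (by positivity)]
          apply ENNReal.ofReal_le_ofReal
          have h0 : 0 ≤ r₁ + r := by linarith
          calc _ ≤ (r₁ + r) ^ d * κ := interVol_le d z _ _ h0
            _ ≤ (3 * r) ^ d * κ := by
              gcongr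
              linarith
            _ = _ := by rw [mul_pow]; ring
        · rw [interVol_zero d z _ _ (by rw [hT]; linarith)]
          simp
    _ = ENNReal.ofReal (3 ^ d * κ) * ∫⁻ r in Ioi T, ENNReal.ofReal (r ^ d) ∂F := by
        rw [lintegral_indicator measurableSet_Ioi, lintegral_const_mul _ (by fun_prop)]
    _ ≤ _ := by
        rw [ENNReal.ofReal_mul (p := 3 ^ d * κ) (by positivity)]
        gcongr
end
end

section
/- Let λ > 0 and let F be a Borel probability measure on [0,∞) with ∫ r^d F(dr) < ∞ that follows a power law with tail exponent α > d, i.e. F̄(r) = F((r,∞)) = ℓ(r)·r^{−α} with ℓ slowly varying. Define the volume fraction p = 1 − exp(−λ ∫ |B_r(0)| F(dr)) and the covariance function k(z) = (1−p)²·(exp(λ ∫ |B_r(0) ∩ B_r(z)| F(dr)) − 1) for z ∈ ℝ^d. Then k(z)/(λ·(1−p)²·c_{α,d}·ℓ(|z|)·|z|^{−(α−d)}) → 1 as |z| → ∞, where c_{α,d} = ∫₀^∞ |B_r(0) ∩ B_r(e₁)|·α·r^{−α−1} dr. -/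
open MeasureTheory Filter Set Metric ProbabilityTheory

noncomputable section

/-- Volume fraction of the Boolean grain cover. -/
def pBool (d : ℕ) (lam : ℝ) (F : Measure ℝ) : ℝ :=
  1 - Real.exp (-(lam * ∫ r, ballVol d r ∂F))

/-- Covariance function of the Boolean grain cover. -/
def kBool (d : ℕ) (lam : ℝ) (F : Measure ℝ) (z : Euc d) : ℝ :=
  (1 - pBool d lam F) ^ 2 *
    (Real.exp (lam * ∫ r, interVol d 0 r z r ∂F) - 1)

/-- Half-width function: `u ∈ B_r(0) ∩ B_r(z)` iff `mfun z u ≤ r`. -/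
def mfun {d : ℕ} (z u : Euc d) : ℝ := max ‖u‖ ‖u - z‖

lemma mfun_cont {d : ℕ} (z : Euc d) : Continuous (mfun z) := by
  unfold mfun; fun_prop

lemma mfun_pos {d : ℕ} {z : Euc d} (hz : z ≠ 0) (u : Euc d) : 0 < mfun z u := by
  unfold mfun
  by_cases h : u = 0
  · subst h; exact lt_max_of_lt_right (by simpa using hz)
  · exact lt_max_of_lt_left (by simpa using h)

lemma mfun_lower {d : ℕ} {z : Euc d} (hz : ‖z‖ = 1) (u : Euc d) :
    1 / 4 * (1 + ‖u‖) ≤ mfun z u := by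
  have h1 : ‖u‖ ≤ mfun z u := le_max_left _ _
  have h2 : ‖u - z‖ ≤ mfun z u := le_max_right _ _
  have h3 : ‖z‖ ≤ ‖u‖ + ‖u - z‖ := by
    have := norm_sub_le u (u - z)
    simpa using this
  linarith

lemma mfun_half {d : ℕ} {z : Euc d} (hz : ‖z‖ = 1) (u : Euc d) :
    1 / 2 ≤ mfun z u := by
  have h1 : ‖u‖ ≤ mfun z u := le_max_left _ _
  have h2 : ‖u - z‖ ≤ mfun z u := le_max_right _ _
  have h3 : ‖z‖ ≤ ‖u‖ + ‖u - z‖ := by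
    have := norm_sub_le u (u - z)
    simpa using this
  linarith

lemma vol_inter {d : ℕ} (hd : 0 < d) (z : Euc d) (r : ℝ) :
    volume (closedBall (0 : Euc d) r ∩ closedBall z r) = volume {u : Euc d | mfun z u < r} := by
  have : Nonempty (Fin d) := ⟨⟨0, hd⟩⟩
  have : {u : Euc d | mfun z u < r} = ball (0 : Euc d) r ∩ ball z r := by
    ext u; simp [mfun, dist_eq_norm]
  rw [this]
  apply measure_congr
  apply EventuallyEq.inter
  · rw [← ball_union_sphere]
    exact union_ae_eq_left_of_ae_eq_empty (ae_eq_empty.2 (Measure.addHaar_sphere volume _ _))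
  · rw [← ball_union_sphere]
    exact union_ae_eq_left_of_ae_eq_empty (ae_eq_empty.2 (Measure.addHaar_sphere volume _ _))

lemma key_fubini {d : ℕ} (hd : 0 < d) (ν : Measure ℝ) [SFinite ν]
    (hν : ∀ s > 0, ν (Ioi s) < ⊤) {z : Euc d} (hz : z ≠ 0) :
    ∫ r, interVol d 0 r z r ∂ν = ∫ u, (ν (Ioi (mfun z u))).toReal := by
  have hS : MeasurableSet {p : ℝ × Euc d | mfun z p.2 < p.1} :=
    measurableSet_lt ((mfun_cont z).measurable.comp measurable_snd) measurable_fst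
  have h1 : ∀ r, interVol d 0 r z r = (volume {u : Euc d | mfun z u < r}).toReal := fun r => by
    rw [interVol, vol_inter hd]
  simp_rw [h1]
  rw [integral_toReal, integral_toReal]
  · congr 1
    have a := Measure.prod_apply (μ := ν) (ν := (volume : Measure (Euc d))) hS
    have b := Measure.prod_apply_symm (μ := ν) (ν := (volume : Measure (Euc d))) hS
    exact a.symm.trans b
  · exact (measurable_measure_prodMk_right (μ := ν) hS).aemeasurable
  · exact Eventually.of_forall fun u => hν _ (mfun_pos hz u)
  · exact (measurable_measure_prodMk_left (ν := (volume : Measure (Euc d))) hS).aemeasurable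
  · refine Eventually.of_forall fun r => ?_
    rw [← vol_inter hd]
    exact (measure_mono inter_subset_left).trans_lt measure_closedBall_lt_top

lemma e1_norm {d : ℕ} (hd : 0 < d) : ‖e1 d‖ = 1 := by
  simp [e1, hd]

lemma e1_ne {d : ℕ} (hd : 0 < d) : e1 d ≠ 0 := by
  intro h; have := e1_norm hd; simp [h] at this

lemma scale {d : ℕ} (hd : 0 < d) (f : ℝ → ℝ) {z : Euc d} (hz : z ≠ 0) :
    ∫ u, f (mfun z u) = ‖z‖ ^ d * ∫ u, f (‖z‖ * mfun (e1 d) u) := by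
  have ht : 0 < ‖z‖ := norm_pos_iff.2 hz
  set t := ‖z‖ with htdef
  have hn : ‖e1 d‖ = ‖t⁻¹ • z‖ := by
    rw [e1_norm hd, norm_smul, norm_inv, norm_norm, inv_mul_cancel₀ ht.ne']
  set R : Euc d ≃ₗᵢ[ℝ] Euc d := Submodule.reflection (Submodule.span ℝ {e1 d - t⁻¹ • z})ᗮ
  have hR : R (e1 d) = t⁻¹ • z := Submodule.reflection_sub hn
  have h2 : ∫ u, f (t * mfun (e1 d) u) = ∫ u, f (mfun z (t • u)) := by
    rw [← R.measurePreserving.integral_comp R.toHomeomorph.measurableEmbedding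
      (fun u => f (mfun z (t • u)))]
    congr 1; ext u; congr 1
    have e2 : t • R u - z = t • R (u - e1 d) := by
      rw [map_sub, hR, smul_sub, smul_inv_smul₀ ht.ne']
    unfold mfun
    rw [e2, norm_smul, norm_smul, R.norm_map, R.norm_map, Real.norm_of_nonneg ht.le,
      mul_max_of_nonneg _ _ ht.le]
  rw [h2, Measure.integral_comp_smul volume (fun u => f (mfun z u))]
  simp only [finrank_euclideanSpace, Fintype.card_fin, smul_eq_mul]
  rw [abs_of_pos (by positivity), mul_inv_cancel_left₀ (by positivity)]

lemma cconst_eq {d : ℕ} (hd : 0 < d) {α : ℝ} (hα : 0 < α) :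
    cconst d α = ∫ u, (mfun (e1 d) u) ^ (-α) := by
  set ν : Measure ℝ := (volume.restrict (Ioi 0)).withDensity
    (fun r => ENNReal.ofReal (α * r ^ (-α - 1))) with hνdef
  have hm : Measurable (fun r : ℝ => ENNReal.ofReal (α * r ^ (-α - 1))) := by fun_prop
  have hI : ∀ s > 0, ν (Ioi s) = ENNReal.ofReal (s ^ (-α)) := by
    intro s hs
    rw [hνdef, withDensity_apply _ measurableSet_Ioi, Measure.restrict_restrict measurableSet_Ioi,
      inter_eq_left.2 (Ioi_subset_Ioi hs.le),
      ← ofReal_integral_eq_lintegral_ofReal]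
    · rw [integral_const_mul, integral_Ioi_rpow_of_lt (by linarith) hs]
      congr 1
      have : -α - 1 + 1 = -α := by ring
      rw [this]; field_simp
    · exact (integrableOn_Ioi_rpow_of_lt (by linarith) hs).const_mul _
    · filter_upwards [ae_restrict_mem measurableSet_Ioi] with x hx
      have : 0 < x := hs.trans hx
      show 0 ≤ _
      positivity
  have h1 := key_fubini hd ν (fun s hs => by rw [hI s hs]; exact ENNReal.ofReal_lt_top) (e1_ne hd)
  have h2 : cconst d α = ∫ r, interVol d 0 r (e1 d) r ∂ν := by
    rw [hνdef, integral_withDensity_eq_integral_toReal_smul hm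
      (Eventually.of_forall fun _ => ENNReal.ofReal_lt_top), cconst]
    apply setIntegral_congr_fun measurableSet_Ioi
    intro r hr
    have : 0 < r := hr
    simp only [smul_eq_mul]
    rw [ENNReal.toReal_ofReal (by positivity), mul_comm]
  rw [h2, h1]
  congr 1; ext u
  have := mfun_pos (e1_ne hd) u
  rw [hI _ this, ENNReal.toReal_ofReal (by positivity)]

lemma mfun_integrable {d : ℕ} (hd : 0 < d) {β : ℝ} (hβ : (d : ℝ) < β) :
    Integrable (fun u : Euc d => (mfun (e1 d) u) ^ (-β)) := by
  have h : Integrable (fun u : Euc d => (1 / 4 : ℝ) ^ (-β) * (1 + ‖u‖) ^ (-β)) :=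
    (integrable_one_add_norm (by simpa using hβ)).const_mul _
  have hβ0 : 0 ≤ β := (Nat.cast_nonneg d).trans hβ.le
  refine h.mono' ?_ (Eventually.of_forall fun u => ?_)
  · exact ((mfun_cont _).measurable.pow_const _).aestronglyMeasurable
  · have := mfun_pos (e1_ne hd) u
    rw [Real.norm_of_nonneg (by positivity), ← Real.mul_rpow (by positivity) (by positivity)]
    exact Real.rpow_le_rpow_of_nonpos (by positivity) (mfun_lower (e1_norm hd) u) (by linarith)

lemma cconst_pos {d : ℕ} (hd : 0 < d) {α : ℝ} (hα : (d : ℝ) < α) : 0 < cconst d α := by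
  rw [cconst_eq hd ((Nat.cast_nonneg d).trans_lt hα)]
  have hp : ∀ u, 0 < (mfun (e1 d) u) ^ (-α) := fun u =>
    Real.rpow_pos_of_pos (mfun_pos (e1_ne hd) u) _
  rw [integral_pos_iff_support_of_nonneg (fun u => (hp u).le) (mfun_integrable hd hα)]
  have : Function.support (fun u => (mfun (e1 d) u) ^ (-α)) = univ := by
    ext u; simpa using (hp u).ne'
  rw [this]
  exact Measure.measure_univ_pos.2 (NeZero.ne _)

/-- Potter-type bound for a nonincreasing function. -/
lemma potter {G : ℝ → ℝ} (hmono : Antitone G) (hpos : ∀ x, 0 ≤ G x) {β t0 : ℝ}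
    (ht0 : 0 < t0) (hβ : 0 < β) (h2 : ∀ t ≥ t0, G (2 * t) ≤ 2 ^ (-β) * G t) :
    ∀ t ≥ t0, ∀ s ≥ 1, G (t * s) ≤ 2 ^ β * s ^ (-β) * G t := by
  intro t ht s hs
  have hiter : ∀ n : ℕ, G (2 ^ n * t) ≤ ((2 : ℝ) ^ n) ^ (-β) * G t := by
    intro n
    induction n with
    | zero => simp
    | succ n ih =>
      have h1 : t0 ≤ 2 ^ n * t := by
        have : (1 : ℝ) ≤ 2 ^ n := one_le_pow₀ (by norm_num)
        nlinarith
      calc G (2 ^ (n + 1) * t) = G (2 * (2 ^ n * t)) := by ring_nf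
        _ ≤ 2 ^ (-β) * G (2 ^ n * t) := h2 _ h1
        _ ≤ 2 ^ (-β) * (((2 : ℝ) ^ n) ^ (-β) * G t) := by gcongr
        _ = _ := by rw [pow_succ, Real.mul_rpow (by positivity) (by positivity)]; ring
  obtain ⟨n, hn1, hn2⟩ := exists_nat_pow_near hs (by norm_num : (1 : ℝ) < 2)
  have htp : 0 < t := ht0.trans_le ht
  calc G (t * s) ≤ G (2 ^ n * t) := hmono (by nlinarith)
    _ ≤ ((2 : ℝ) ^ n) ^ (-β) * G t := hiter n
    _ ≤ 2 ^ β * s ^ (-β) * G t := by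
      refine mul_le_mul_of_nonneg_right ?_ (hpos t)
      have e : (2 : ℝ) ^ β * s ^ (-β) = (s / 2) ^ (-β) := by
        rw [Real.div_rpow (by linarith) (by norm_num), Real.rpow_neg (by norm_num : (0:ℝ) ≤ 2) β,
          div_inv_eq_mul, mul_comm]
      rw [e]
      refine Real.rpow_le_rpow_of_nonpos (by positivity) ?_ (by linarith)
      rw [pow_succ] at hn2
      linarith

lemma tail_ratio {ℓ : ℝ → ℝ} (hℓ : SlowlyVarying ℓ) {G : ℝ → ℝ} {α : ℝ}
    (htail : ∀ x > 0, G x = ℓ x * x ^ (-α)) {a : ℝ} (ha : 0 < a) :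
    Tendsto (fun t => G (t * a) / G t) atTop (nhds (a ^ (-α))) := by
  have h := (hℓ.2.2 a ha).mul_const (a ^ (-α))
  rw [one_mul] at h
  refine h.congr' ?_
  filter_upwards [eventually_gt_atTop 0] with t ht
  have := hℓ.2.1 t ht
  have h3 : (0 : ℝ) < t ^ (-α) := by positivity
  rw [htail _ (by positivity), htail t ht, Real.mul_rpow ht.le ha.le, mul_comm a t]
  field_simp

/-- Combined analytic statement. -/
lemma main_ratio {d : ℕ} (hd : 0 < d) {G ℓ : ℝ → ℝ} {α : ℝ} (hα : (d : ℝ) < α)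
    (hℓ : SlowlyVarying ℓ) (hmono : Antitone G) (hG : ∀ x, 0 ≤ G x)
    (htail : ∀ x > 0, G x = ℓ x * x ^ (-α)) :
    Tendsto (fun t => ∫ u, G (t * mfun (e1 d) u) / G t) atTop (nhds (cconst d α)) ∧
    Tendsto (fun t => t ^ d * G t) atTop (nhds 0) := by
  have hd0 : (0 : ℝ) ≤ d := Nat.cast_nonneg d
  obtain ⟨β, hβ1, hβ2⟩ := exists_between hα
  have hβ0 : 0 < β := hd0.trans_lt hβ1
  have hGpos : ∀ x > 0, 0 < G x := fun x hx => by
    rw [htail x hx]; exact mul_pos (hℓ.2.1 x hx) (by positivity)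
  have hev : ∀ᶠ t in atTop, G (t * 2) / G t < 2 ^ (-β) :=
    (tail_ratio hℓ htail (by norm_num : (0 : ℝ) < 2)).eventually_lt_const
      (Real.rpow_lt_rpow_of_exponent_lt (by norm_num) (by linarith))
  obtain ⟨t1, ht1⟩ := eventually_atTop.1 hev
  set t0 := max t1 1 with ht0def
  have ht0 : 0 < t0 := lt_max_of_lt_right one_pos
  have hP := potter hmono hG ht0 hβ0 (fun t ht => by
    have := ht1 t ((le_max_left _ _).trans ht)
    rw [div_lt_iff₀ (hGpos t (ht0.trans_le ht))] at this
    rw [mul_comm 2 t]; exact this.le)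
  constructor
  · rw [cconst_eq hd (hd0.trans_lt hα)]
    have hhalf := (tail_ratio hℓ htail (by norm_num : (0 : ℝ) < 1 / 2)).eventually_lt_const
      (lt_add_one _)
    set K : ℝ := (1 / 2 : ℝ) ^ (-α) + 1
    refine tendsto_integral_filter_of_dominated_convergence
      (fun u => K * (mfun (e1 d) u) ^ (-β)) ?_ ?_ ?_ ?_
    · refine Eventually.of_forall fun t => ?_
      exact ((hmono.measurable.comp ((mfun_cont _).measurable.const_mul t)).div_const
        _).aestronglyMeasurable
    · filter_upwards [hhalf, eventually_ge_atTop (2 * t0)] with t hK ht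
      refine Eventually.of_forall fun u => ?_
      have hm := mfun_half (e1_norm hd) u
      set s := mfun (e1 d) u
      have htp : 0 < t := by linarith
      have hGt := hGpos t htp
      rw [Real.norm_of_nonneg (div_nonneg (hG _) (hG _)), div_le_iff₀ hGt]
      rw [div_lt_iff₀ hGt] at hK
      have h1 := hP (t * (1 / 2)) (by linarith) (2 * s) (by linarith)
      have e1 : t * (1 / 2) * (2 * s) = t * s := by ring
      have e2 : (2 : ℝ) ^ β * (2 * s) ^ (-β) = s ^ (-β) := by
        rw [Real.mul_rpow (by norm_num) (by linarith), ← mul_assoc,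
          ← Real.rpow_add (by norm_num)]
        simp
      rw [e1, e2] at h1
      have : 0 ≤ s ^ (-β) := Real.rpow_nonneg (by linarith) _
      nlinarith
    · exact (mfun_integrable hd hβ1).const_mul _
    · exact Eventually.of_forall fun u => tail_ratio hℓ htail (mfun_pos (e1_ne hd) u)
  · have hlim : Tendsto (fun t : ℝ => (2 ^ β * t0 ^ β * G t0) * t ^ (-(β - d))) atTop (nhds 0) := by
      simpa using (tendsto_rpow_neg_atTop (by linarith : 0 < β - d)).const_mul
        (2 ^ β * t0 ^ β * G t0)
    refine squeeze_zero' ?_ ?_ hlim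
    · filter_upwards [eventually_ge_atTop 0] with t ht using mul_nonneg (by positivity) (hG t)
    · filter_upwards [eventually_ge_atTop t0] with t ht
      have htp : 0 < t := ht0.trans_le ht
      have h := hP t0 le_rfl (t / t0) ((one_le_div ht0).2 ht)
      rw [mul_div_cancel₀ t ht0.ne', Real.div_rpow htp.le ht0.le, Real.rpow_neg ht0.le β,
        div_inv_eq_mul] at h
      calc t ^ d * G t ≤ t ^ d * (2 ^ β * (t ^ (-β) * t0 ^ β) * G t0) := by gcongr
        _ = (2 ^ β * t0 ^ β * G t0) * (t ^ (d : ℝ) * t ^ (-β)) := by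
          rw [Real.rpow_natCast]; ring
        _ = _ := by rw [← Real.rpow_add htp]; ring_nf

/-- Power-law decay of the covariance function of a Boolean model with power-law
grain radii: `k(z) ∼ λ (1-p)² c_{α,d} ℓ(|z|) |z|^{-(α-d)}` as `|z| → ∞`. -/
theorem stmt7 (d : ℕ) (hd : 0 < d) (lam : ℝ) (hlam : 0 < lam)
    (F : Measure ℝ) [IsProbabilityMeasure F] (hsupp : F (Iio 0) = 0)
    (hmom : Integrable (fun r : ℝ => r ^ d) F)
    (α : ℝ) (hα : (d : ℝ) < α)
    (ℓ : ℝ → ℝ) (hℓ : SlowlyVarying ℓ)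
    (htail : ∀ x > 0, tailF F x = ℓ x * x ^ (-α)) :
    Tendsto
      (fun z : Euc d =>
        kBool d lam F z /
          (lam * (1 - pBool d lam F) ^ 2 * cconst d α * ℓ ‖z‖ * ‖z‖ ^ (-(α - d))))
      (comap norm atTop) (nhds 1) := by
  have hmono : Antitone (tailF F) := fun x y h =>
    ENNReal.toReal_mono (measure_ne_top _ _) (measure_mono (Ioi_subset_Ioi h))
  have hG : ∀ x, 0 ≤ tailF F x := fun x => ENNReal.toReal_nonneg
  obtain ⟨hr, h0⟩ := main_ratio hd hα hℓ hmono hG htail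
  have hc := cconst_pos hd hα
  set c := cconst d α with hcdef
  set J : ℝ → ℝ := fun t => ∫ u, tailF F (t * mfun (e1 d) u) / tailF F t with hJ
  have hA : ∀ z : Euc d, 0 < ‖z‖ →
      ∫ r, interVol d 0 r z r ∂F = (‖z‖ ^ d * tailF F ‖z‖) * J ‖z‖ := by
    intro z hz
    have hz0 : z ≠ 0 := norm_pos_iff.1 hz
    have hGz : tailF F ‖z‖ ≠ 0 := by
      rw [htail _ hz]; exact (mul_pos (hℓ.2.1 _ hz) (by positivity)).ne'
    have h1 := key_fubini hd F (fun s _ => measure_lt_top _ _) hz0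
    have h2 := scale hd (tailF F) hz0
    rw [h1]
    change ∫ u, tailF F (mfun z u) = _
    rw [h2]
    simp only [hJ]
    rw [integral_div]
    field_simp
  have hX : Tendsto (fun t : ℝ => lam * ((t ^ d * tailF F t) * J t)) atTop (nhds 0) := by
    simpa using (h0.mul hr).const_mul lam
  have hds : Tendsto (dslope Real.exp 0) (nhds 0) (nhds 1) := by
    have : ContinuousAt (dslope Real.exp 0) 0 :=
      continuousAt_dslope_same.2 Real.differentiableAt_exp
    simpa [ContinuousAt, dslope_same] using this
  have hfin : Tendsto (fun t : ℝ => dslope Real.exp 0 (lam * ((t ^ d * tailF F t) * J t)) *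
      (J t / c)) atTop (nhds 1) := by
    have := (hds.comp hX).mul (hr.div_const c)
    rw [div_self hc.ne', one_mul] at this
    exact this
  refine (hfin.comp (tendsto_comap (f := (norm : Euc d → ℝ)))).congr' ?_
  filter_upwards [tendsto_comap.eventually (eventually_gt_atTop (0 : ℝ))] with z hz
  have hp : 0 < 1 - pBool d lam F := by
    unfold pBool; rw [sub_sub_cancel]; exact Real.exp_pos _
  have hl := hℓ.2.1 _ hz
  have hexp : ∀ x : ℝ, Real.exp x - 1 = x * dslope Real.exp 0 x := fun x => by
    have := sub_smul_dslope Real.exp 0 x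
    simpa using this.symm
  simp only [Function.comp, kBool]
  rw [hA z hz, hexp, htail _ hz]
  have hpow : ‖z‖ ^ (-(α - d)) = ‖z‖ ^ d * ‖z‖ ^ (-α) := by
    rw [← Real.rpow_natCast ‖z‖ d, ← Real.rpow_add hz]; ring_nf
  rw [hpow]
  have h3 : 0 < ‖z‖ ^ (-α) := by positivity
  generalize dslope Real.exp 0 _ = D
  field_simp
end
end

section
/- Fix λ > 0, a Borel probability measure F on [0,∞) with ∫ r^d F(dr) < ∞, and a probability kernel G = (G_r)_{r≥0} on [0,∞), and let h and q be the weight-averaged retention probability and retention covariance function defined by the explicit formulas below. For z ∈ ℝ^d let A(z) = {(x, r₁, r₂) ∈ ℝ^d × [0,∞) × [0,∞) : |x−z| ≤ 2(r₁+r₂)}. Then ∭_{A(z)} |B_{r₁}(0) ∩ B_{r₂}(x)|·|q(|x−z|, r₁, r₂)| dx F(dr₁) F(dr₂) ≤ 2·|B_1(0)|²·(∫ r^d F(dr))·(∫_{(|z|/6,∞)} r^d F(dr))·sup_{r > |z|/6} h(r). -/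
open MeasureTheory Filter Set Metric ProbabilityTheory

noncomputable section

/-- Retention probability of a grain with radius `r` and weight `w`. -/
def hret (d : ℕ) (lam : ℝ) (F : Measure ℝ) (G : Kernel ℝ ℝ) (r w : ℝ) : ℝ :=
  Real.exp (-(lam * ∫ s, ballVol d (r + s) * ((G s) (Ici w)).toReal ∂F))

/-- Weight-averaged retention probability of a grain with radius `r`. -/
def havg (d : ℕ) (lam : ℝ) (F : Measure ℝ) (G : Kernel ℝ ℝ) (r : ℝ) : ℝ :=
  ∫ w, hret d lam F G r w ∂(G r)

/-- Pair retention probability of grains with radii `r₁, r₂`, weights `w₁, w₂` and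
centers at distance `u` apart. -/
def h2ret (d : ℕ) (lam : ℝ) (F : Measure ℝ) (G : Kernel ℝ ℝ)
    (u r₁ w₁ r₂ w₂ : ℝ) : ℝ :=
  if u ≤ r₁ + r₂ then 0
  else
    hret d lam F G r₁ w₁ * hret d lam F G r₂ w₂ *
      Real.exp (lam * ∫ r, interVol d 0 (r + r₁) (u • e1 d) (r + r₂) *
        ((G r) (Ici (max w₁ w₂))).toReal ∂F)

/-- Weight-averaged pair retention probability. -/
def h2avg (d : ℕ) (lam : ℝ) (F : Measure ℝ) (G : Kernel ℝ ℝ) (u r₁ r₂ : ℝ) : ℝ :=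
  ∫ w₁, ∫ w₂, h2ret d lam F G u r₁ w₁ r₂ w₂ ∂(G r₂) ∂(G r₁)

/-- Retention covariance function `q(u,r₁,r₂) = h₂(u,r₁,r₂) - h(r₁) h(r₂)`. -/
def qret (d : ℕ) (lam : ℝ) (F : Measure ℝ) (G : Kernel ℝ ℝ) (u r₁ r₂ : ℝ) : ℝ :=
  h2avg d lam F G u r₁ r₂ - havg d lam F G r₁ * havg d lam F G r₂


lemma x_ballVol_nonneg (d : ℕ) (r : ℝ) : 0 ≤ ballVol d r := ENNReal.toReal_nonneg

lemma x_interVol_nonneg (d : ℕ) (x y : Euc d) (r s : ℝ) : 0 ≤ interVol d x r y s :=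
  ENNReal.toReal_nonneg

lemma x_ballVol_eq (d : ℕ) (r : ℝ) (hr : 0 ≤ r) : ballVol d r = r ^ d * ballVol d 1 := by
  unfold ballVol
  rw [Measure.addHaar_closedBall' volume (0 : Euc d) hr]
  simp [ENNReal.toReal_mul, ENNReal.toReal_ofReal (pow_nonneg hr d)]

lemma x_ballVol_mono (d : ℕ) : Monotone (ballVol d) := by
  intro a b hab
  exact ENNReal.toReal_mono measure_closedBall_lt_top.ne
    (measure_mono (closedBall_subset_closedBall hab))

lemma x_vol_closedBall (d : ℕ) (x : Euc d) (r : ℝ) :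
    (volume (closedBall x r)).toReal = ballVol d r := by
  unfold ballVol
  rw [Measure.addHaar_closedBall_center]

lemma x_interVol_le_right (d : ℕ) (x y : Euc d) (r s : ℝ) :
    interVol d x r y s ≤ ballVol d s := by
  rw [← x_vol_closedBall d y]
  exact ENNReal.toReal_mono measure_closedBall_lt_top.ne (measure_mono inter_subset_right)

lemma x_interVol_le_left (d : ℕ) (x y : Euc d) (r s : ℝ) :
    interVol d x r y s ≤ ballVol d r := by
  rw [← x_vol_closedBall d x]
  exact ENNReal.toReal_mono measure_closedBall_lt_top.ne (measure_mono inter_subset_left)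

lemma x_integrable (d : ℕ) (F : Measure ℝ) [IsProbabilityMeasure F] (hsupp : F (Iio 0) = 0)
    (hmom : Integrable (fun r : ℝ => r ^ d) F)
    (G : Kernel ℝ ℝ) [IsMarkovKernel G] (r w : ℝ) :
    Integrable (fun s => ballVol d (r + s) * ((G s) (Ici w)).toReal) F := by
  have h0 : ∀ᵐ s ∂F, 0 ≤ s := by
    rw [ae_iff]; simpa [Iio] using hsupp
  have hm : Measurable (fun s => ballVol d (r + s) * ((G s) (Ici w)).toReal) := by
    apply Measurable.mul
    · exact (x_ballVol_mono d).measurable.comp (measurable_const.add measurable_id)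
    · exact (Kernel.measurable_coe G measurableSet_Ici).ennreal_toReal
  have hi : Integrable (fun s : ℝ => 2 ^ (d - 1) * (|r| ^ d + s ^ d) * ballVol d 1) F :=
    (((integrable_const _).add hmom).const_mul _).mul_const _
  refine hi.mono' hm.aestronglyMeasurable ?_
  filter_upwards [h0] with s hs
  have h1 : ((G s) (Ici w)).toReal ≤ 1 := by
    have := ENNReal.toReal_mono ENNReal.one_ne_top (prob_le_one (μ := G s) (s := Ici w))
    simpa using this
  rw [Real.norm_of_nonneg (mul_nonneg (x_ballVol_nonneg _ _) ENNReal.toReal_nonneg)]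
  calc ballVol d (r + s) * ((G s) (Ici w)).toReal ≤ ballVol d (r + s) * 1 :=
        mul_le_mul_of_nonneg_left h1 (x_ballVol_nonneg _ _)
    _ ≤ ballVol d (|r| + s) := by
        rw [mul_one]; exact x_ballVol_mono d (by linarith [le_abs_self r])
    _ = (|r| + s) ^ d * ballVol d 1 := x_ballVol_eq d _ (by positivity)
    _ ≤ _ := mul_le_mul_of_nonneg_right (add_pow_le (abs_nonneg r) hs d) (x_ballVol_nonneg _ _)

lemma x_hret_nonneg (d : ℕ) (lam : ℝ) (F : Measure ℝ) (G : Kernel ℝ ℝ) (r w : ℝ) :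
    0 ≤ hret d lam F G r w := (Real.exp_pos _).le

lemma x_hret_le_one (d : ℕ) (lam : ℝ) (hlam : 0 < lam) (F : Measure ℝ) (G : Kernel ℝ ℝ)
    (r w : ℝ) : hret d lam F G r w ≤ 1 := by
  unfold hret
  rw [Real.exp_le_one_iff, neg_nonpos]
  exact mul_nonneg hlam.le (integral_nonneg fun s =>
    mul_nonneg (x_ballVol_nonneg _ _) ENNReal.toReal_nonneg)

lemma x_hret_mono (d : ℕ) (lam : ℝ) (hlam : 0 < lam) (F : Measure ℝ) [IsProbabilityMeasure F]
    (hsupp : F (Iio 0) = 0) (hmom : Integrable (fun r : ℝ => r ^ d) F)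
    (G : Kernel ℝ ℝ) [IsMarkovKernel G] (r : ℝ) : Monotone (hret d lam F G r) := by
  intro a b hab
  unfold hret
  apply Real.exp_le_exp.mpr
  apply neg_le_neg
  apply mul_le_mul_of_nonneg_left _ hlam.le
  apply integral_mono (x_integrable d F hsupp hmom G r b) (x_integrable d F hsupp hmom G r a)
  intro s
  apply mul_le_mul_of_nonneg_left _ (x_ballVol_nonneg _ _)
  exact ENNReal.toReal_mono (measure_ne_top _ _) (measure_mono (Ici_subset_Ici.mpr hab))

lemma x_hret_integrable (d : ℕ) (lam : ℝ) (hlam : 0 < lam) (F : Measure ℝ)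
    [IsProbabilityMeasure F]
    (hsupp : F (Iio 0) = 0) (hmom : Integrable (fun r : ℝ => r ^ d) F)
    (G : Kernel ℝ ℝ) [IsMarkovKernel G] (r : ℝ) (μ : Measure ℝ) [IsProbabilityMeasure μ] :
    Integrable (hret d lam F G r) μ := by
  refine (integrable_const (1 : ℝ)).mono'
    (x_hret_mono d lam hlam F hsupp hmom G r).measurable.aestronglyMeasurable ?_
  filter_upwards with w
  rw [Real.norm_of_nonneg (x_hret_nonneg _ _ _ _ _ _)]
  exact x_hret_le_one d lam hlam F G r w

lemma x_havg_nonneg (d : ℕ) (lam : ℝ) (F : Measure ℝ) (G : Kernel ℝ ℝ) (r : ℝ) :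
    0 ≤ havg d lam F G r := integral_nonneg fun w => x_hret_nonneg _ _ _ _ _ _

lemma x_havg_le_one (d : ℕ) (lam : ℝ) (hlam : 0 < lam) (F : Measure ℝ)
    (G : Kernel ℝ ℝ) [IsMarkovKernel G] (r : ℝ) : havg d lam F G r ≤ 1 := by
  have : havg d lam F G r ≤ ∫ w, (1 : ℝ) ∂(G r) :=
    integral_mono_of_nonneg (ae_of_all _ fun w => x_hret_nonneg _ _ _ _ _ _)
      (integrable_const _) (ae_of_all _ fun w => x_hret_le_one d lam hlam F G r w)
  simpa using this

lemma x_h2ret_nonneg (d : ℕ) (lam : ℝ) (F : Measure ℝ) (G : Kernel ℝ ℝ) (u r₁ w₁ r₂ w₂ : ℝ) :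
    0 ≤ h2ret d lam F G u r₁ w₁ r₂ w₂ := by
  unfold h2ret
  split_ifs
  · exact le_rfl
  · exact mul_nonneg (mul_nonneg (x_hret_nonneg _ _ _ _ _ _) (x_hret_nonneg _ _ _ _ _ _))
      (Real.exp_pos _).le

lemma x_h2ret_le_left (d : ℕ) (lam : ℝ) (hlam : 0 < lam) (F : Measure ℝ) [IsProbabilityMeasure F]
    (hsupp : F (Iio 0) = 0) (hmom : Integrable (fun r : ℝ => r ^ d) F)
    (G : Kernel ℝ ℝ) [IsMarkovKernel G] (u r₁ w₁ r₂ w₂ : ℝ) :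
    h2ret d lam F G u r₁ w₁ r₂ w₂ ≤ hret d lam F G r₁ w₁ := by
  unfold h2ret
  split_ifs
  · exact x_hret_nonneg _ _ _ _ _ _
  · rw [mul_assoc]
    apply mul_le_of_le_one_right (x_hret_nonneg _ _ _ _ _ _)
    unfold hret
    rw [← Real.exp_add, Real.exp_le_one_iff]
    have : ∫ r, interVol d 0 (r + r₁) (u • e1 d) (r + r₂) *
        ((G r) (Ici (max w₁ w₂))).toReal ∂F
        ≤ ∫ s, ballVol d (r₂ + s) * ((G s) (Ici w₂)).toReal ∂F := by
      apply integral_mono_of_nonneg _ (x_integrable d F hsupp hmom G r₂ w₂)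
      · refine ae_of_all _ fun s => ?_
        apply mul_le_mul _ _ ENNReal.toReal_nonneg (x_ballVol_nonneg _ _)
        · rw [add_comm r₂ s]; exact x_interVol_le_right _ _ _ _ _
        · exact ENNReal.toReal_mono (measure_ne_top _ _)
            (measure_mono (Ici_subset_Ici.mpr (le_max_right _ _)))
      · exact ae_of_all _ fun s => mul_nonneg (x_interVol_nonneg _ _ _ _ _) ENNReal.toReal_nonneg
    have := mul_le_mul_of_nonneg_left this hlam.le
    linarith

lemma x_h2ret_le_right (d : ℕ) (lam : ℝ) (hlam : 0 < lam) (F : Measure ℝ) [IsProbabilityMeasure F]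
    (hsupp : F (Iio 0) = 0) (hmom : Integrable (fun r : ℝ => r ^ d) F)
    (G : Kernel ℝ ℝ) [IsMarkovKernel G] (u r₁ w₁ r₂ w₂ : ℝ) :
    h2ret d lam F G u r₁ w₁ r₂ w₂ ≤ hret d lam F G r₂ w₂ := by
  unfold h2ret
  split_ifs
  · exact x_hret_nonneg _ _ _ _ _ _
  · rw [mul_comm (hret d lam F G r₁ w₁), mul_assoc]
    apply mul_le_of_le_one_right (x_hret_nonneg _ _ _ _ _ _)
    unfold hret
    rw [← Real.exp_add, Real.exp_le_one_iff]
    have : ∫ r, interVol d 0 (r + r₁) (u • e1 d) (r + r₂) *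
        ((G r) (Ici (max w₁ w₂))).toReal ∂F
        ≤ ∫ s, ballVol d (r₁ + s) * ((G s) (Ici w₁)).toReal ∂F := by
      apply integral_mono_of_nonneg _ (x_integrable d F hsupp hmom G r₁ w₁)
      · refine ae_of_all _ fun s => ?_
        apply mul_le_mul _ _ ENNReal.toReal_nonneg (x_ballVol_nonneg _ _)
        · rw [add_comm r₁ s]; exact x_interVol_le_left _ _ _ _ _
        · exact ENNReal.toReal_mono (measure_ne_top _ _)
            (measure_mono (Ici_subset_Ici.mpr (le_max_left _ _)))
      · exact ae_of_all _ fun s => mul_nonneg (x_interVol_nonneg _ _ _ _ _) ENNReal.toReal_nonneg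
    have := mul_le_mul_of_nonneg_left this hlam.le
    linarith

lemma x_q_le (d : ℕ) (lam : ℝ) (hlam : 0 < lam) (F : Measure ℝ) [IsProbabilityMeasure F]
    (hsupp : F (Iio 0) = 0) (hmom : Integrable (fun r : ℝ => r ^ d) F)
    (G : Kernel ℝ ℝ) [IsMarkovKernel G] (u r₁ r₂ : ℝ) :
    |qret d lam F G u r₁ r₂| ≤ havg d lam F G r₁ ∧
    |qret d lam F G u r₁ r₂| ≤ havg d lam F G r₂ := by
  have n1 := x_havg_nonneg d lam F G r₁
  have n2 := x_havg_nonneg d lam F G r₂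
  have o1 := x_havg_le_one d lam hlam F G r₁
  have o2 := x_havg_le_one d lam hlam F G r₂
  have k0 : 0 ≤ h2avg d lam F G u r₁ r₂ :=
    integral_nonneg fun w₁ => integral_nonneg fun w₂ => x_h2ret_nonneg _ _ _ _ _ _ _ _ _
  have k1 : h2avg d lam F G u r₁ r₂ ≤ havg d lam F G r₁ := by
    apply integral_mono_of_nonneg
    · exact ae_of_all _ fun w₁ => integral_nonneg fun w₂ => x_h2ret_nonneg _ _ _ _ _ _ _ _ _
    · exact x_hret_integrable d lam hlam F hsupp hmom G r₁ _
    · refine ae_of_all _ fun w₁ => ?_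
      have : ∫ w₂, h2ret d lam F G u r₁ w₁ r₂ w₂ ∂(G r₂) ≤
          ∫ w₂, hret d lam F G r₁ w₁ ∂(G r₂) :=
        integral_mono_of_nonneg (ae_of_all _ fun w₂ => x_h2ret_nonneg _ _ _ _ _ _ _ _ _)
          (integrable_const _)
          (ae_of_all _ fun w₂ => x_h2ret_le_left d lam hlam F hsupp hmom G _ _ _ _ _)
      simpa using this
  have k2 : h2avg d lam F G u r₁ r₂ ≤ havg d lam F G r₂ := by
    have : h2avg d lam F G u r₁ r₂ ≤ ∫ w₁, havg d lam F G r₂ ∂(G r₁) := by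
      apply integral_mono_of_nonneg
      · exact ae_of_all _ fun w₁ => integral_nonneg fun w₂ => x_h2ret_nonneg _ _ _ _ _ _ _ _ _
      · exact integrable_const _
      · refine ae_of_all _ fun w₁ => ?_
        exact integral_mono_of_nonneg (ae_of_all _ fun w₂ => x_h2ret_nonneg _ _ _ _ _ _ _ _ _)
          (x_hret_integrable d lam hlam F hsupp hmom G r₂ _)
          (ae_of_all _ fun w₂ => x_h2ret_le_right d lam hlam F hsupp hmom G _ _ _ _ _)
    simpa using this
  unfold qret
  have p0 := mul_nonneg n1 n2
  have p1 : havg d lam F G r₁ * havg d lam F G r₂ ≤ havg d lam F G r₁ :=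
    mul_le_of_le_one_right n1 o2
  have p2 : havg d lam F G r₁ * havg d lam F G r₂ ≤ havg d lam F G r₂ :=
    mul_le_of_le_one_left n2 o1
  constructor <;> rw [abs_le] <;> constructor <;> linarith

lemma x_meas_set (d : ℕ) (r₁ r₂ : ℝ) :
    MeasurableSet {p : Euc d × Euc d | p.2 ∈ closedBall (0 : Euc d) r₁ ∩ closedBall p.1 r₂} := by
  have : {p : Euc d × Euc d | p.2 ∈ closedBall (0 : Euc d) r₁ ∩ closedBall p.1 r₂} =
      {p : Euc d × Euc d | dist p.2 0 ≤ r₁} ∩ {p | dist p.2 p.1 ≤ r₂} := by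
    ext p; simp [mem_closedBall]
  rw [this]
  exact ((isClosed_le (by fun_prop) (by fun_prop)).inter
    (isClosed_le (by fun_prop) (by fun_prop))).measurableSet

lemma x_interVol_meas (d : ℕ) (r₁ r₂ : ℝ) :
    Measurable (fun x : Euc d => volume (closedBall (0 : Euc d) r₁ ∩ closedBall x r₂)) :=
  measurable_measure_prodMk_left (ν := (volume : Measure (Euc d))) (x_meas_set d r₁ r₂)

lemma x_lintegral (d : ℕ) (r₁ r₂ : ℝ) :
    ∫⁻ x : Euc d, volume (closedBall (0 : Euc d) r₁ ∩ closedBall x r₂) =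
      volume (closedBall (0 : Euc d) r₁) * volume (closedBall (0 : Euc d) r₂) := by
  have h1 := Measure.prod_apply (μ := (volume : Measure (Euc d))) (ν := (volume : Measure (Euc d)))
    (x_meas_set d r₁ r₂)
  have h2 := Measure.prod_apply_symm (μ := (volume : Measure (Euc d)))
    (ν := (volume : Measure (Euc d))) (x_meas_set d r₁ r₂)
  have h3 : ∀ y : Euc d, volume ((fun x : Euc d => (x, y)) ⁻¹'
      {p : Euc d × Euc d | p.2 ∈ closedBall (0 : Euc d) r₁ ∩ closedBall p.1 r₂}) =
      (closedBall (0 : Euc d) r₁).indicator (fun _ => volume (closedBall (0 : Euc d) r₂)) y := by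
    intro y
    by_cases hy : y ∈ closedBall (0 : Euc d) r₁
    · rw [indicator_of_mem hy, ← Measure.addHaar_closedBall_center volume y r₂]
      congr 1
      ext x
      have e : dist y x = dist x y := dist_comm y x
      constructor
      · intro hx
        exact e.symm.trans_le (show dist y x ≤ r₂ from hx.2)
      · intro hx
        exact ⟨hy, e.trans_le (show dist x y ≤ r₂ from hx)⟩
    · rw [indicator_of_notMem hy]
      convert measure_empty (μ := (volume : Measure (Euc d)))
      ext x
      simp only [mem_preimage, mem_setOf_eq, mem_inter_iff, hy, false_and, mem_empty_iff_false]
  have h4 : ∫⁻ x : Euc d, volume (closedBall (0 : Euc d) r₁ ∩ closedBall x r₂) = _ := h1.symm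
  rw [h4, h2]
  simp_rw [h3]
  rw [lintegral_indicator measurableSet_closedBall, setLIntegral_const, mul_comm]

lemma x_interVol_integral (d : ℕ) (r₁ r₂ : ℝ) :
    Integrable (fun x : Euc d => interVol d 0 r₁ x r₂) ∧
      ∫ x : Euc d, interVol d 0 r₁ x r₂ = ballVol d r₁ * ballVol d r₂ := by
  have hfin : ∫⁻ x : Euc d, volume (closedBall (0 : Euc d) r₁ ∩ closedBall x r₂) ≠ ⊤ := by
    rw [x_lintegral]
    exact ENNReal.mul_ne_top measure_closedBall_lt_top.ne measure_closedBall_lt_top.ne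
  constructor
  · exact integrable_toReal_of_lintegral_ne_top (x_interVol_meas d r₁ r₂).aemeasurable hfin
  · unfold interVol
    rw [integral_toReal (x_interVol_meas d r₁ r₂).aemeasurable
      (ae_lt_top (x_interVol_meas d r₁ r₂) hfin), x_lintegral, ENNReal.toReal_mul]
    rfl

/-- Bound for the inner integral by a uniform bound on `q`. -/
lemma x_inner_le (d : ℕ) (r₁ r₂ c : ℝ) (A : Set (Euc d)) (f : Euc d → ℝ)
    (hf0 : ∀ x, 0 ≤ f x) (hf : ∀ x, f x ≤ c) :
    ∫ x in A, interVol d 0 r₁ x r₂ * f x ≤ ballVol d r₁ * ballVol d r₂ * c := by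
  obtain ⟨hi, he⟩ := x_interVol_integral d r₁ r₂
  have hc : 0 ≤ c := (hf0 0).trans (hf 0)
  calc ∫ x in A, interVol d 0 r₁ x r₂ * f x ≤ ∫ x in A, interVol d 0 r₁ x r₂ * c := by
        apply integral_mono_of_nonneg
        · exact ae_of_all _ fun x => mul_nonneg (x_interVol_nonneg _ _ _ _ _) (hf0 x)
        · exact hi.integrableOn.mul_const c
        · exact ae_of_all _ fun x => mul_le_mul_of_nonneg_left (hf x) (x_interVol_nonneg _ _ _ _ _)
    _ ≤ ∫ x, interVol d 0 r₁ x r₂ * c :=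
        setIntegral_le_integral (hi.mul_const c)
          (ae_of_all _ fun x => mul_nonneg (x_interVol_nonneg _ _ _ _ _) hc)
    _ = _ := by rw [integral_mul_const, he]

lemma x_inner_zero (d : ℕ) (hd : 0 < d) (r₁ r₂ : ℝ) (z : Euc d) (f : Euc d → ℝ)
    (h1 : r₁ ≤ ‖z‖ / 6) (h2 : r₂ ≤ ‖z‖ / 6) :
    ∫ x in {x : Euc d | ‖x - z‖ ≤ 2 * (r₁ + r₂)}, interVol d 0 r₁ x r₂ * f x = 0 := by
  have : Nontrivial (Euc d) := by
    haveI : Nonempty (Fin d) := ⟨⟨0, hd⟩⟩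
    infer_instance
  have hm : MeasurableSet {x : Euc d | ‖x - z‖ ≤ 2 * (r₁ + r₂)} :=
    (isClosed_le (by fun_prop) (by fun_prop)).measurableSet
  have hs : ∀ᵐ x : Euc d, x ∉ sphere (0 : Euc d) (r₁ + r₂) :=
    measure_eq_zero_iff_ae_notMem.mp (Measure.addHaar_sphere (volume : Measure (Euc d)) 0 (r₁ + r₂))
  apply integral_eq_zero_of_ae
  rw [Filter.EventuallyEq, ae_restrict_iff' hm]
  filter_upwards [hs] with x hx hA
  have hx1 : ‖x‖ ≠ r₁ + r₂ := by simpa using hx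
  have hA : ‖x - z‖ ≤ 2 * (r₁ + r₂) := hA
  have h3 : ‖z‖ ≤ ‖x‖ + ‖x - z‖ := by
    have := norm_sub_le x (x - z)
    simpa using this
  have hx2 : r₁ + r₂ < ‖x‖ := lt_of_le_of_ne (by linarith) hx1.symm
  have : closedBall (0 : Euc d) r₁ ∩ closedBall x r₂ = ∅ := by
    ext y
    simp only [mem_inter_iff, mem_closedBall, mem_empty_iff_false, iff_false, not_and, not_le]
    intro hy
    by_contra! hh
    have := dist_triangle x y 0
    rw [dist_comm x y, dist_zero_right x] at this
    linarith
  simp [interVol, this]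

/-- Bound on the triple integral of the retention covariance over the near-diagonal
region `A(z) = {(x,r₁,r₂) : |x-z| ≤ 2(r₁+r₂)}`. -/
theorem stmt10 (d : ℕ) (hd : 0 < d) (lam : ℝ) (hlam : 0 < lam)
    (F : Measure ℝ) [IsProbabilityMeasure F] (hsupp : F (Iio 0) = 0)
    (hmom : Integrable (fun r : ℝ => r ^ d) F)
    (G : Kernel ℝ ℝ) [IsMarkovKernel G] (z : Euc d) :
    (∫ r₁, (∫ r₂, (∫ x in {x : Euc d | ‖x - z‖ ≤ 2 * (r₁ + r₂)},
        interVol d 0 r₁ x r₂ * |qret d lam F G (‖x - z‖) r₁ r₂|) ∂F) ∂F) ≤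
      2 * ballVol d 1 ^ 2 * (∫ r, r ^ d ∂F) * (∫ r in Ioi (‖z‖ / 6), r ^ d ∂F) *
        ⨆ r ∈ Ioi (‖z‖ / 6), havg d lam F G r := by
  have h0 : ∀ᵐ s ∂F, 0 ≤ s := by
    rw [ae_iff]; simpa [Iio] using hsupp
  set t := ‖z‖ / 6 with ht
  set S := ⨆ r ∈ Ioi t, havg d lam F G r with hS
  have hin : ∀ r, (⨆ (_ : r ∈ Ioi t), havg d lam F G r) ≤ 1 := fun r =>
    Real.iSup_le (fun _ => x_havg_le_one d lam hlam F G r) zero_le_one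
  have hSle : ∀ r, t < r → havg d lam F G r ≤ S := by
    intro r hr
    have hb : BddAbove (range fun r => ⨆ (_ : r ∈ Ioi t), havg d lam F G r) :=
      ⟨1, by rintro _ ⟨r, rfl⟩; exact hin r⟩
    have hle := le_ciSup hb r
    have hne : Nonempty (r ∈ Ioi t) := ⟨hr⟩
    simp only [ciSup_const] at hle
    exact hle
  have hS0 : 0 ≤ S := Real.iSup_nonneg fun r => Real.iSup_nonneg fun _ => x_havg_nonneg _ _ _ _ _
  set κ := ballVol d 1 with hκ
  have hκ0 : 0 ≤ κ := x_ballVol_nonneg _ _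
  set m := ∫ r, r ^ d ∂F with hm
  set T := ∫ r in Ioi t, r ^ d ∂F with hT
  let g : ℝ → ℝ := (Ioi t).indicator (fun r => r ^ d)
  have hgi : Integrable g F := hmom.indicator measurableSet_Ioi
  have hgT : ∫ r, g r ∂F = T := integral_indicator measurableSet_Ioi
  have hg1 : ∀ r, t < r → g r = r ^ d := fun r hr => indicator_of_mem (mem_Ioi.mpr hr) _
  have hg0 : ∀ r, 0 ≤ r → 0 ≤ g r := fun r hr => by
    by_cases h : t < r
    · rw [hg1 r h]; positivity
    · exact (indicator_of_notMem (by simpa using h) _).ge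
  have key : ∀ r₁ r₂, 0 ≤ r₁ → 0 ≤ r₂ →
      (∫ x in {x : Euc d | ‖x - z‖ ≤ 2 * (r₁ + r₂)},
        interVol d 0 r₁ x r₂ * |qret d lam F G (‖x - z‖) r₁ r₂|) ≤
      κ ^ 2 * S * (g r₁ * r₂ ^ d + r₁ ^ d * g r₂) := by
    intro r₁ r₂ p1 p2
    have a1 := hg0 r₁ p1
    have a2 := hg0 r₂ p2
    have b1 : 0 ≤ r₁ ^ d := by positivity
    have b2 : 0 ≤ r₂ ^ d := by positivity
    by_cases c1 : t < r₁
    · refine (x_inner_le d r₁ r₂ S _ _ (fun x => abs_nonneg _)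
        (fun x => (x_q_le d lam hlam F hsupp hmom G _ _ _).1.trans (hSle _ c1))).trans ?_
      rw [x_ballVol_eq d r₁ p1, x_ballVol_eq d r₂ p2, hg1 r₁ c1]
      have : 0 ≤ κ ^ 2 * S * (r₁ ^ d * g r₂) := by positivity
      linarith
    · by_cases c2 : t < r₂
      · refine (x_inner_le d r₁ r₂ S _ _ (fun x => abs_nonneg _)
          (fun x => (x_q_le d lam hlam F hsupp hmom G _ _ _).2.trans (hSle _ c2))).trans ?_
        rw [x_ballVol_eq d r₁ p1, x_ballVol_eq d r₂ p2, hg1 r₂ c2]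
        have : 0 ≤ κ ^ 2 * S * (g r₁ * r₂ ^ d) := by positivity
        linarith
      · rw [x_inner_zero d hd r₁ r₂ z _ (not_lt.mp c1) (not_lt.mp c2)]
        positivity
  have nn : ∀ r₁ r₂, 0 ≤ (∫ x in {x : Euc d | ‖x - z‖ ≤ 2 * (r₁ + r₂)},
        interVol d 0 r₁ x r₂ * |qret d lam F G (‖x - z‖) r₁ r₂|) := fun r₁ r₂ =>
    integral_nonneg fun x => mul_nonneg (x_interVol_nonneg _ _ _ _ _) (abs_nonneg _)
  have step : ∀ r₁, 0 ≤ r₁ → (∫ r₂, (∫ x in {x : Euc d | ‖x - z‖ ≤ 2 * (r₁ + r₂)},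
        interVol d 0 r₁ x r₂ * |qret d lam F G (‖x - z‖) r₁ r₂|) ∂F) ≤
      κ ^ 2 * S * (g r₁ * m + r₁ ^ d * T) := by
    intro r₁ p1
    have e : ∫ r₂, κ ^ 2 * S * (g r₁ * r₂ ^ d + r₁ ^ d * g r₂) ∂F =
        κ ^ 2 * S * (g r₁ * m + r₁ ^ d * T) := by
      rw [integral_const_mul, integral_add (hmom.const_mul _) (hgi.const_mul _),
        integral_const_mul, integral_const_mul, hgT]
    rw [← e]
    apply integral_mono_of_nonneg (ae_of_all _ fun r₂ => nn r₁ r₂)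
    · exact ((hmom.const_mul _).add (hgi.const_mul _)).const_mul _
    · filter_upwards [h0] with r₂ p2
      exact key r₁ r₂ p1 p2
  have e : ∫ r₁, κ ^ 2 * S * (g r₁ * m + r₁ ^ d * T) ∂F = 2 * κ ^ 2 * m * T * S := by
    rw [integral_const_mul, integral_add (hgi.mul_const _) (hmom.mul_const _),
        integral_mul_const, integral_mul_const, hgT]
    ring
  rw [← e]
  apply integral_mono_of_nonneg (ae_of_all _ fun r₁ => integral_nonneg fun r₂ => nn r₁ r₂)
  · exact ((hgi.mul_const _).add (hmom.mul_const _)).const_mul _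
  · filter_upwards [h0] with r₁ p1
    exact step r₁ p1
end
end
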